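/- Let G be a countable group, Σ a nonempty finite alphabet, Ω a relative system over G with alphabet Σ, Φ an absolutely summable relative interaction on Ω, A ⊆ G a finite set, and K_A the Gibbs kernel for A associated to Φ. Let μ be a probability measure on Ω, and for each u ∈ Σ^A let q_u be a version of the conditional expectation E_μ[1_{[u]} | ξ^{G∖A} ∨ F_Θ]. Then: (1) for μ-almost every (θ,x) ∈ Ω, −Σ_{u∈Σ^A} q_u(θ,x)·log q_u(θ,x) − Σ_{u∈Σ^A} q_u(θ,x)·E_{A|A^c}(θ, x_{G∖A}∨u) ≤ log Z_{A|A^c}(θ,x), and for μ-almost every (θ,x) equality holds at (θ,x) if and only if q_u(θ,x) = K_A((θ,x),[u]) for every u ∈ Σ^A; and (2) Ψ_μ(A | A^c) ≤ Ψ_{μK_A}(A | A^c), with equality if and only if μK_A = μ. -/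

import Mathlib

open MeasureTheory Filter Topology
open scoped Pointwise ENNReal
noncomputable section

namespace DLR

variable (G : Type) [Group G] [Countable G] [DecidableEq G]
variable (S : Type) [Fintype S] [Nonempty S] [TopologicalSpace S] [DiscreteTopology S]
  [MeasurableSpace S] [MeasurableSingletonClass S]
variable (Θ : Type) [MeasurableSpace Θ]

/-- The translation action of `G` on configurations: `(g • x)_k = x_{g⁻¹ k}`. -/
def shift (g : G) (x : G → S) : G → S := fun k => x (g⁻¹ * k)

/-- A relative system over `G` with alphabet `S` and environment space `Θ`. -/
structure RelSystem where
  act : G → Θ → Θ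
  act_one : ∀ θ, act 1 θ = θ
  act_mul : ∀ g h θ, act (g * h) θ = act g (act h θ)
  act_measurable : ∀ g, Measurable (act g)
  X : Θ → Set (G → S)
  X_closed : ∀ θ, IsClosed (X θ)
  omega_measurable : MeasurableSet {p : Θ × (G → S) | p.2 ∈ X p.1}
  X_equivariant : ∀ g θ, X (act g θ) = (shift G S g) '' (X θ)

variable {G S Θ}

/-- The total space of a relative system, as a subset of `Θ × Σ^G`. -/
def RelSystem.Omega (R : RelSystem G S Θ) : Set (Θ × (G → S)) := {p | p.2 ∈ R.X p.1}

/-- The σ-algebra on `Θ × Σ^G` generated by the environment coordinate. -/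
def FTheta : MeasurableSpace (Θ × (G → S)) := MeasurableSpace.comap Prod.fst inferInstance

/-- The σ-algebra on `Θ × Σ^G` generated by the configuration restricted to `B ⊆ G`. -/
def xi (B : Set G) : MeasurableSpace (Θ × (G → S)) :=
  MeasurableSpace.comap (fun p => (fun b : B => p.2 b)) inferInstance

/-- The cylinder set of a pattern `u` with support a finite set `A ⊆ G`. -/
def cyl (A : Finset G) (u : A → S) : Set (Θ × (G → S)) := {p | ∀ a : A, p.2 a = u a}

/-- Merging a pattern `u` on `A` with a configuration `x` off `A`: `x_{G∖A} ∨ u`. -/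
def mergePat (A : Finset G) (x : G → S) (u : A → S) : G → S :=
  fun k => if h : k ∈ A then u ⟨k, h⟩ else x k

/-- A bounded relatively continuous observable (membership in `C_Θ(Ω)`). -/
def RelCont (R : RelSystem G S Θ) (f : Θ × (G → S) → ℝ) : Prop :=
  Measurable f ∧ (∃ c : ℝ, ∀ p ∈ R.Omega, |f p| ≤ c) ∧
    ∀ ε > 0, ∃ A : Finset G, ∀ θ : Θ, ∀ x ∈ R.X θ, ∀ y ∈ R.X θ,
      (∀ a ∈ A, x a = y a) → |f (θ, x) - f (θ, y)| < ε

variable (G S Θ) in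
/-- A relative interaction on a relative system. -/
structure Interaction (R : RelSystem G S Θ) where
  Phi : Finset G → Θ × (G → S) → ℝ
  measurable' : ∀ A : Finset G, Measurable[FTheta ⊔ xi (↑A : Set G)] (Phi A)
  bounded' : ∀ A : Finset G, ∃ c : ℝ, ∀ p, |Phi A p| ≤ c
  equivariant' : ∀ (g : G) (A : Finset G) (p : Θ × (G → S)),
    Phi (A.image (g * ·)) p = Phi A (R.act g⁻¹ p.1, shift G S g⁻¹ p.2)

variable {R : RelSystem G S Θ}

/-- The supremum norm of the `A`-component of an interaction. -/
def supAbs {α : Type} (f : α → ℝ) : ℝ := ⨆ p, |f p|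

/-- Absolute summability of a relative interaction. -/
def Interaction.AbsSummable (Φ : Interaction G S Θ R) : Prop :=
  Summable (fun A : Finset G => if (1 : G) ∈ A then supAbs (Φ.Phi A) else 0)

/-- The norm `‖Φ‖` of an absolutely summable interaction. -/
def Interaction.norm (Φ : Interaction G S Θ R) : ℝ :=
  ∑' A : Finset G, if (1 : G) ∈ A then supAbs (Φ.Phi A) else 0

/-- The energy `E_A = Σ_{C ⊆ A} Φ_C` of a finite region `A`. -/
def energy (Φ : Interaction G S Θ R) (A : Finset G) (p : Θ × (G → S)) : ℝ :=
  ∑ C ∈ A.powerset, Φ.Phi C p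

/-- The conditional energy `E_{A|A^c} = Σ_{C ∩ A ≠ ∅} Φ_C`. -/
def condEnergy (Φ : Interaction G S Θ R) (A : Finset G) (p : Θ × (G → S)) : ℝ :=
  ∑' C : Finset G, if (C ∩ A).Nonempty then Φ.Phi C p else 0

/-- The conditional energy `E_{A|B} = E_{A∪B} - E_B` for finite `A`, `B`. -/
def condEnergyFin (Φ : Interaction G S Θ R) (A B : Finset G) (p : Θ × (G → S)) : ℝ :=
  energy Φ (A ∪ B) p - energy Φ B p

open Classical in
/-- The partition function `Z_{A|A^c}(θ,x)`. -/
def partitionZ (Φ : Interaction G S Θ R) (A : Finset G) (p : Θ × (G → S)) : ℝ :=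
  ∑ u : A → S, if mergePat A p.2 u ∈ R.X p.1
    then Real.exp (-(condEnergy Φ A (p.1, mergePat A p.2 u))) else 0

open Classical in
/-- The Gibbs kernel `K_A((θ,x),·)` associated to an interaction. -/
def gibbsKernel (Φ : Interaction G S Θ R) (A : Finset G) (p : Θ × (G → S)) :
    Measure (Θ × (G → S)) :=
  ∑ u : A → S, if mergePat A p.2 u ∈ R.X p.1
    then (ENNReal.ofReal (Real.exp (-(condEnergy Φ A (p.1, mergePat A p.2 u))) /
            partitionZ Φ A p)) • Measure.dirac (p.1, mergePat A p.2 u)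
    else 0

/-- Conditional entropy `H_μ(ξ^A | m)` of the partition into `A`-cylinders given
a sub-σ-algebra `m`, defined via conditional expectation. -/
def condEntropy (μ : Measure (Θ × (G → S))) (A : Finset G)
    (m : MeasurableSpace (Θ × (G → S))) : ℝ :=
  ∫ p, (∑ u : A → S,
    Real.negMulLog ((μ[Set.indicator (cyl A u) (fun _ => (1:ℝ)) | m]) p)) ∂μ

/-- The conditional relative pressure `Ψ_μ(A | A^c)`. -/
def pressureCond (Φ : Interaction G S Θ R) (μ : Measure (Θ × (G → S))) (A : Finset G) : ℝ :=
  condEntropy μ A (xi ((↑A : Set G)ᶜ) ⊔ FTheta) - ∫ p, condEnergy Φ A p ∂μ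

/-- The conditional relative pressure `Ψ_μ(A | B)` for finite disjoint `A`, `B`. -/
def pressureCondFin (Φ : Interaction G S Θ R) (μ : Measure (Θ × (G → S)))
    (A B : Finset G) : ℝ :=
  condEntropy μ A (xi (↑B : Set G) ⊔ FTheta) - ∫ p, condEnergyFin Φ A B p ∂μ

/-- Weak topological Markov property relative to `Θ`. -/
def RelSystem.WeakTMP (R : RelSystem G S Θ) : Prop :=
  ∀ A : Finset G, ∃ B : Finset G, A ⊆ B ∧ ∀ θ : Θ, ∀ x ∈ R.X θ, ∀ x' ∈ R.X θ,
    (∀ g ∈ B \ A, x g = x' g) → (fun g => if g ∈ B then x g else x' g) ∈ R.X θ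

/-- A right Følner sequence in a countable group. -/
def RightFolner (F : ℕ → Finset G) : Prop :=
  (∀ n, (F n).Nonempty) ∧
  ∀ g : G, Tendsto (fun n => ((symmDiff (F n) ((F n).image (· * g))).card : ℝ) / (F n).card)
    atTop (𝓝 0)

set_option linter.unusedSectionVars false

section FiniteVariationalPrinciple

lemma negMulLog_add_mul_log_le {q w : ℝ} (hq : 0 ≤ q) (hw : 0 < w) :
    Real.negMulLog q + q * Real.log w ≤ w - q ∧
      (Real.negMulLog q + q * Real.log w = w - q ↔ q = w) := by
  rcases hq.eq_or_lt with rfl | hq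
  · simp [hw.le, hw.ne, Real.negMulLog_zero]
  have key : Real.negMulLog q + q * Real.log w = q * Real.log (w / q) := by
    rw [Real.log_div hw.ne' hq.ne', Real.negMulLog]; ring
  have key' : w - q = q * (w / q - 1) := by field_simp
  rcases eq_or_ne q w with rfl | hne
  · rw [key]; simp [hq.ne']
  · have hlt : Real.negMulLog q + q * Real.log w < w - q := by
      rw [key, key']
      refine mul_lt_mul_of_pos_left (Real.log_lt_sub_one_of_pos (div_pos hw hq) ?_) hq
      rw [Ne, div_eq_one_iff_eq hq.ne']
      exact hne.symm
    exact ⟨hlt.le, iff_of_false hlt.ne hne⟩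

/-- The finitary variational principle: among probability vectors `q` supported where the
Gibbs vector `w ∝ exp (-E)` is, the functional `H(q) - ∑ q E` is maximal exactly at `w`. -/
lemma finite_variational_principle {ι : Type*} [Fintype ι] {q w E : ι → ℝ} {L : ℝ}
    (hq : ∀ u, 0 ≤ q u) (hqs : ∑ u, q u = 1) (hws : ∑ u, w u = 1)
    (h : ∀ u, (w u = 0 ∧ q u = 0) ∨ (0 < w u ∧ Real.log (w u) = -E u - L)) :
    (∑ u, Real.negMulLog (q u)) - ∑ u, q u * E u ≤ L ∧
      ((∑ u, Real.negMulLog (q u)) - ∑ u, q u * E u = L ↔ ∀ u, q u = w u) := by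
  have term : ∀ u, Real.negMulLog (q u) - q u * E u ≤ q u * L + (w u - q u) ∧
      (Real.negMulLog (q u) - q u * E u = q u * L + (w u - q u) ↔ q u = w u) := by
    intro u
    rcases h u with ⟨h1, h2⟩ | ⟨h1, h2⟩
    · simp [h1, h2]
    · obtain ⟨hle, heq⟩ := negMulLog_add_mul_log_le (hq u) h1
      rw [h2] at hle heq
      refine ⟨by linarith, Iff.trans ⟨fun h => ?_, fun h => ?_⟩ heq⟩ <;> linarith
  have hsum : ∑ u, (q u * L + (w u - q u)) = L := by
    rw [Finset.sum_add_distrib, Finset.sum_sub_distrib, ← Finset.sum_mul, hqs, hws]; ring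
  rw [← Finset.sum_sub_distrib]
  refine ⟨(Finset.sum_le_sum fun u _ => (term u).1).trans_eq hsum, ?_⟩
  conv_lhs => rw [← hsum]
  rw [Finset.sum_eq_sum_iff_of_le fun u _ => (term u).1]
  simp [fun u => (term u).2]

end FiniteVariationalPrinciple

/-- The σ-algebra `ξ^{G∖A} ∨ F_Θ` generated by the environment and the configuration off `A`. -/
abbrev outside (A : Finset G) : MeasurableSpace (Θ × (G → S)) := xi ((↑A : Set G)ᶜ) ⊔ FTheta

/-- The point `(θ, x_{G∖A} ∨ u)`. -/
def mergePoint (A : Finset G) (u : A → S) (p : Θ × (G → S)) : Θ × (G → S) :=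
  (p.1, mergePat A p.2 u)

lemma FTheta_le : (FTheta : MeasurableSpace (Θ × (G → S))) ≤ Prod.instMeasurableSpace :=
  measurable_fst.comap_le

lemma xi_le (B : Set G) : (xi B : MeasurableSpace (Θ × (G → S))) ≤ Prod.instMeasurableSpace :=
  Measurable.comap_le
    (measurable_pi_lambda _ fun b => (measurable_pi_apply (b : G)).comp measurable_snd)

lemma outside_le (A : Finset G) :
    (outside A : MeasurableSpace (Θ × (G → S))) ≤ Prod.instMeasurableSpace :=
  sup_le (xi_le _) FTheta_le

lemma measurable_mergePoint_outside (A : Finset G) (u : A → S) :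
    Measurable[outside A] (mergePoint A u : Θ × (G → S) → Θ × (G → S)) := by
  refine Measurable.prodMk ((comap_measurable Prod.fst).mono le_sup_right le_rfl) ?_
  refine @measurable_pi_lambda _ _ _ (outside A) _ _ fun k => ?_
  by_cases hk : k ∈ A
  · simp only [mergePat, hk, dite_true]
    exact measurable_const
  · simp only [mergePat, hk, dite_false]
    have h1 : Measurable[xi ((↑A : Set G)ᶜ)]
        (fun p : Θ × (G → S) => fun b : ((↑A : Set G)ᶜ : Set G) => p.2 b) :=
      comap_measurable _
    exact ((measurable_pi_apply (⟨k, by simpa using hk⟩ : ((↑A : Set G)ᶜ : Set G))).comp h1).mono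
      le_sup_left le_rfl

lemma measurable_mergePoint (A : Finset G) (u : A → S) :
    Measurable (mergePoint A u : Θ × (G → S) → Θ × (G → S)) :=
  (measurable_mergePoint_outside A u).mono (outside_le A) le_rfl

lemma mergePoint_eq_self_of_mem_cyl {A : Finset G} {u : A → S} {p : Θ × (G → S)}
    (h : p ∈ cyl A u) : mergePoint A u p = p := by
  refine Prod.ext rfl (funext fun k => ?_)
  by_cases hk : k ∈ A
  · simpa [mergePoint, mergePat, hk] using (h ⟨k, hk⟩).symm
  · simp [mergePoint, mergePat, hk]

lemma mem_cyl_iff {A : Finset G} {u : A → S} {p : Θ × (G → S)} :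
    p ∈ cyl A u ↔ (fun a : A => p.2 a) = u := by
  simp [cyl, funext_iff]

lemma mergePoint_mem_cyl_iff {A : Finset G} {u v : A → S} {p : Θ × (G → S)} :
    mergePoint A v p ∈ cyl A u ↔ v = u := by
  rw [mem_cyl_iff]
  simp [mergePoint, mergePat]

lemma measurableSet_cyl (A : Finset G) (u : A → S) :
    MeasurableSet (cyl A u : Set (Θ × (G → S))) := by
  have : (cyl A u : Set (Θ × (G → S))) = (fun p => fun a : A => p.2 a) ⁻¹' {u} := by
    ext p; simp [mem_cyl_iff]
  rw [this]
  exact measurableSet_preimage (by fun_prop) (measurableSet_singleton u)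

/-- Events measurable off `A` do not see the pattern on `A`. -/
lemma mergePoint_mem_iff_of_outside {A : Finset G} {s : Set (Θ × (G → S))}
    (hs : MeasurableSet[outside A] s) (u : A → S) (p : Θ × (G → S)) :
    mergePoint A u p ∈ s ↔ p ∈ s := by
  have hle : outside A ≤ MeasurableSpace.comap
      (fun p : Θ × (G → S) => ((fun b : ((↑A : Set G)ᶜ : Set G) => p.2 b), p.1)) ⊤ := by
    refine sup_le ?_ ?_
    · rintro _ ⟨t, -, rfl⟩
      exact ⟨Prod.fst ⁻¹' t, trivial, rfl⟩
    · rintro _ ⟨t, -, rfl⟩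
      exact ⟨Prod.snd ⁻¹' t, trivial, rfl⟩
  obtain ⟨t, -, rfl⟩ := hle _ hs
  have : (fun b : ((↑A : Set G)ᶜ : Set G) => (mergePoint A u p).2 b) =
      fun b : ((↑A : Set G)ᶜ : Set G) => p.2 b := by
    funext b
    have hb : (b : G) ∉ A := fun h => b.2 (Finset.mem_coe.2 h)
    simp [mergePoint, mergePat, hb]
  simp only [Set.mem_preimage, this]
  rfl

section Energy

lemma abs_le_supAbs (Φ : Interaction G S Θ R) (C : Finset G) (p : Θ × (G → S)) :
    |Φ.Phi C p| ≤ supAbs (Φ.Phi C) := by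
  obtain ⟨c, hc⟩ := Φ.bounded' C
  exact le_ciSup (f := fun p => |Φ.Phi C p|) ⟨c, by rintro _ ⟨p, rfl⟩; exact hc p⟩ p

lemma supAbs_nonneg {α : Type} (f : α → ℝ) : 0 ≤ supAbs f :=
  Real.iSup_nonneg fun _ => abs_nonneg _

lemma supAbs_image_le (Φ : Interaction G S Θ R) (g : G) (C : Finset G) :
    supAbs (Φ.Phi (C.image (g * ·))) ≤ supAbs (Φ.Phi C) := by
  refine Real.iSup_le (fun p => ?_) (supAbs_nonneg _)
  rw [Φ.equivariant']
  exact abs_le_supAbs Φ C _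

lemma summable_supAbs_of_mem {Φ : Interaction G S Θ R} (hΦ : Φ.AbsSummable) (g : G) :
    Summable fun C : Finset G => if g ∈ C then supAbs (Φ.Phi C) else 0 := by
  have hinj : Function.Injective fun C : Finset G => C.image (g⁻¹ * ·) :=
    Finset.image_injective (mul_right_injective g⁻¹)
  refine Summable.of_nonneg_of_le (fun C => ?_) (fun C => ?_) (hΦ.comp_injective hinj)
  · split_ifs
    exacts [supAbs_nonneg _, le_rfl]
  · have hmem : (1 : G) ∈ C.image (g⁻¹ * ·) ↔ g ∈ C := by
      simp
    simp only [Function.comp, hmem]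
    split_ifs
    · have := supAbs_image_le Φ g (C.image (g⁻¹ * ·))
      rwa [Finset.image_image, show (g * ·) ∘ (g⁻¹ * ·) = id by funext; simp,
        Finset.image_id] at this
    · exact le_rfl

lemma summable_supAbs_of_inter {Φ : Interaction G S Θ R} (hΦ : Φ.AbsSummable) (A : Finset G) :
    Summable fun C : Finset G => if (C ∩ A).Nonempty then supAbs (Φ.Phi C) else 0 := by
  refine Summable.of_nonneg_of_le (fun C => ?_) (fun C => ?_)
    (summable_sum fun g (_ : g ∈ A) => summable_supAbs_of_mem hΦ g)
  · split_ifs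
    exacts [supAbs_nonneg _, le_rfl]
  · have hnn : ∀ g ∈ A, 0 ≤ if g ∈ C then supAbs (Φ.Phi C) else 0 := fun g _ => by
      split_ifs
      exacts [supAbs_nonneg _, le_rfl]
    split_ifs with h
    · obtain ⟨g, hg⟩ := h
      rw [Finset.mem_inter] at hg
      refine le_trans ?_ (Finset.single_le_sum hnn hg.2)
      simp [hg.1]
    · exact Finset.sum_nonneg hnn

lemma norm_condEnergy_term_le (Φ : Interaction G S Θ R) (A C : Finset G) (p : Θ × (G → S)) :
    ‖if (C ∩ A).Nonempty then Φ.Phi C p else 0‖ ≤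
      if (C ∩ A).Nonempty then supAbs (Φ.Phi C) else 0 := by
  split_ifs
  · exact abs_le_supAbs Φ C p
  · simp

lemma exists_abs_condEnergy_le {Φ : Interaction G S Θ R} (hΦ : Φ.AbsSummable) (A : Finset G) :
    ∃ c, ∀ p, |condEnergy Φ A p| ≤ c :=
  ⟨_, fun p => tsum_of_norm_bounded (summable_supAbs_of_inter hΦ A).hasSum
    fun C => norm_condEnergy_term_le Φ A C p⟩

lemma measurable_condEnergy {Φ : Interaction G S Θ R} (hΦ : Φ.AbsSummable) (A : Finset G) :
    Measurable (condEnergy Φ A) := by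
  refine measurable_of_tendsto_metrizable' (u := atTop)
    (f := fun (T : Finset (Finset G)) p =>
      ∑ C ∈ T, if (C ∩ A).Nonempty then Φ.Phi C p else 0) (fun T => ?_) ?_
  · refine Finset.measurable_sum _ fun C _ => ?_
    split_ifs
    · exact (Φ.measurable' C).mono (sup_le FTheta_le (xi_le _)) le_rfl
    · exact measurable_const
  · exact tendsto_pi_nhds.2 fun p => (Summable.of_norm_bounded
      (summable_supAbs_of_inter hΦ A) fun C => norm_condEnergy_term_le Φ A C p).hasSum

end Energy

section Kernel

/-- The Boltzmann factor `exp (-E_{A|A^c})` on `Ω`, extended by zero. -/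
def boltzmann (Φ : Interaction G S Θ R) (A : Finset G) : Θ × (G → S) → ℝ :=
  R.Omega.indicator fun p => Real.exp (-condEnergy Φ A p)

/-- The weight which the Gibbs kernel at `p` gives to the pattern `u`. -/
def gibbsWeight (Φ : Interaction G S Θ R) (A : Finset G) (u : A → S) (p : Θ × (G → S)) : ℝ :=
  boltzmann Φ A (mergePoint A u p) / partitionZ Φ A p

lemma boltzmann_nonneg (Φ : Interaction G S Θ R) (A : Finset G) (p : Θ × (G → S)) :
    0 ≤ boltzmann Φ A p :=
  Set.indicator_nonneg (fun _ _ => (Real.exp_pos _).le) p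

lemma boltzmann_of_mem (Φ : Interaction G S Θ R) (A : Finset G) {p : Θ × (G → S)}
    (hp : p ∈ R.Omega) : boltzmann Φ A p = Real.exp (-condEnergy Φ A p) :=
  Set.indicator_of_mem hp _

lemma boltzmann_of_notMem (Φ : Interaction G S Θ R) (A : Finset G) {p : Θ × (G → S)}
    (hp : p ∉ R.Omega) : boltzmann Φ A p = 0 :=
  Set.indicator_of_notMem hp _

lemma partitionZ_eq_sum (Φ : Interaction G S Θ R) (A : Finset G) (p : Θ × (G → S)) :
    partitionZ Φ A p = ∑ u : A → S, boltzmann Φ A (mergePoint A u p) := by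
  refine Finset.sum_congr rfl fun u _ => ?_
  split_ifs with h
  · exact (boltzmann_of_mem Φ A (p := mergePoint A u p) h).symm
  · exact (boltzmann_of_notMem Φ A (p := mergePoint A u p) h).symm

lemma gibbsKernel_eq_sum (Φ : Interaction G S Θ R) (A : Finset G) (p : Θ × (G → S)) :
    gibbsKernel Φ A p = ∑ u : A → S,
      ENNReal.ofReal (gibbsWeight Φ A u p) • Measure.dirac (mergePoint A u p) := by
  refine Finset.sum_congr rfl fun u _ => ?_
  split_ifs with h
  · rw [gibbsWeight, boltzmann_of_mem Φ A (p := mergePoint A u p) h]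
    rfl
  · rw [gibbsWeight, boltzmann_of_notMem Φ A (p := mergePoint A u p) h]
    simp

lemma gibbsKernel_apply (Φ : Interaction G S Θ R) (A : Finset G) (p : Θ × (G → S))
    {W : Set (Θ × (G → S))} (hW : MeasurableSet W) :
    gibbsKernel Φ A p W = ∑ u : A → S,
      ENNReal.ofReal (gibbsWeight Φ A u p) * W.indicator 1 (mergePoint A u p) := by
  simp [gibbsKernel_eq_sum, Measure.dirac_apply' _ hW]

lemma partitionZ_nonneg (Φ : Interaction G S Θ R) (A : Finset G) (p : Θ × (G → S)) :
    0 ≤ partitionZ Φ A p := by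
  rw [partitionZ_eq_sum]
  exact Finset.sum_nonneg fun u _ => boltzmann_nonneg Φ A _

lemma partitionZ_pos (Φ : Interaction G S Θ R) (A : Finset G) {p : Θ × (G → S)}
    (hp : p ∈ R.Omega) : 0 < partitionZ Φ A p := by
  rw [partitionZ_eq_sum]
  refine Finset.sum_pos' (fun u _ => boltzmann_nonneg Φ A _)
    ⟨fun a => p.2 a, Finset.mem_univ _, ?_⟩
  rw [mergePoint_eq_self_of_mem_cyl (mem_cyl_iff.2 rfl), boltzmann_of_mem Φ A hp]
  exact Real.exp_pos _

lemma gibbsWeight_nonneg (Φ : Interaction G S Θ R) (A : Finset G) (u : A → S)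
    (p : Θ × (G → S)) : 0 ≤ gibbsWeight Φ A u p :=
  div_nonneg (boltzmann_nonneg Φ A _) (partitionZ_nonneg Φ A p)

lemma gibbsWeight_le_one (Φ : Interaction G S Θ R) (A : Finset G) (u : A → S)
    (p : Θ × (G → S)) : gibbsWeight Φ A u p ≤ 1 := by
  refine div_le_one_of_le₀ ?_ (partitionZ_nonneg Φ A p)
  rw [partitionZ_eq_sum]
  exact Finset.single_le_sum (f := fun u => boltzmann Φ A (mergePoint A u p))
    (fun u _ => boltzmann_nonneg Φ A _) (Finset.mem_univ u)

lemma sum_gibbsWeight (Φ : Interaction G S Θ R) (A : Finset G) {p : Θ × (G → S)}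
    (hp : p ∈ R.Omega) : ∑ u : A → S, gibbsWeight Φ A u p = 1 := by
  simp only [gibbsWeight]
  rw [← Finset.sum_div, ← partitionZ_eq_sum, div_self (partitionZ_pos Φ A hp).ne']

lemma gibbsKernel_cyl_toReal (Φ : Interaction G S Θ R) (A : Finset G) (u : A → S)
    (p : Θ × (G → S)) :
    (gibbsKernel Φ A p (cyl A u)).toReal = gibbsWeight Φ A u p := by
  classical
  rw [gibbsKernel_apply Φ A p (measurableSet_cyl A u)]
  simp [Set.indicator_apply, mergePoint_mem_cyl_iff, gibbsWeight_nonneg]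

variable {Φ : Interaction G S Θ R}

lemma measurable_boltzmann (hΦ : Φ.AbsSummable) (A : Finset G) : Measurable (boltzmann Φ A) :=
  (measurable_condEnergy hΦ A).neg.exp.indicator R.omega_measurable

lemma measurable_gibbsWeight_outside (hΦ : Φ.AbsSummable) (A : Finset G) (u : A → S) :
    Measurable[outside A] (gibbsWeight Φ A u) := by
  have hb : ∀ u : A → S, Measurable[outside A] fun p => boltzmann Φ A (mergePoint A u p) :=
    fun u => (measurable_boltzmann hΦ A).comp (measurable_mergePoint_outside A u)
  refine (hb u).div ?_
  simp only [funext (partitionZ_eq_sum Φ A)]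
  exact Finset.measurable_sum _ fun u _ => hb u

lemma measurable_gibbsWeight (hΦ : Φ.AbsSummable) (A : Finset G) (u : A → S) :
    Measurable (gibbsWeight Φ A u) :=
  (measurable_gibbsWeight_outside hΦ A u).mono (outside_le A) le_rfl

lemma measurable_gibbsKernel (hΦ : Φ.AbsSummable) (A : Finset G) :
    Measurable (gibbsKernel Φ A) := by
  refine Measure.measurable_of_measurable_coe _ fun W hW => ?_
  simp only [gibbsKernel_apply Φ A _ hW]
  exact Finset.measurable_sum _ fun u _ => (measurable_gibbsWeight hΦ A u).ennreal_ofReal.mul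
    ((measurable_one.indicator hW).comp (measurable_mergePoint A u))

lemma bind_gibbsKernel_apply (hΦ : Φ.AbsSummable) (A : Finset G) (μ : Measure (Θ × (G → S)))
    {W : Set (Θ × (G → S))} (hW : MeasurableSet W) :
    μ.bind (gibbsKernel Φ A) W = ∫⁻ p, ∑ u : A → S,
      ENNReal.ofReal (gibbsWeight Φ A u p) * W.indicator 1 (mergePoint A u p) ∂μ := by
  rw [Measure.bind_apply hW (measurable_gibbsKernel hΦ A).aemeasurable]
  simp only [gibbsKernel_apply Φ A _ hW]

variable {μ : Measure (Θ × (G → S))} [IsProbabilityMeasure μ]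

lemma ae_mem_Omega (hμ : μ R.Omega = 1) : ∀ᵐ p ∂μ, p ∈ R.Omega :=
  (mem_ae_iff_prob_eq_one R.omega_measurable).2 hμ

lemma bind_gibbsKernel_apply_outside (hΦ : Φ.AbsSummable) (A : Finset G)
    (hμ : μ R.Omega = 1) {s : Set (Θ × (G → S))} (hs : MeasurableSet[outside A] s) :
    μ.bind (gibbsKernel Φ A) s = μ s := by
  have hs' : MeasurableSet s := outside_le A _ hs
  rw [bind_gibbsKernel_apply hΦ A μ hs', ← lintegral_indicator_one hs']
  refine lintegral_congr_ae ?_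
  filter_upwards [ae_mem_Omega hμ] with p hp
  have hind : ∀ u : A → S, s.indicator (1 : Θ × (G → S) → ℝ≥0∞)
      (mergePoint A u p) = s.indicator 1 p := by
    classical
    intro u
    simp [Set.indicator_apply, mergePoint_mem_iff_of_outside hs]
  simp only [hind]
  rw [← Finset.sum_mul, ← ENNReal.ofReal_sum_of_nonneg fun u _ => gibbsWeight_nonneg Φ A u p,
    sum_gibbsWeight Φ A hp]
  simp

lemma isProbabilityMeasure_bind_gibbsKernel (hΦ : Φ.AbsSummable) (A : Finset G)
    (hμ : μ R.Omega = 1) : IsProbabilityMeasure (μ.bind (gibbsKernel Φ A)) :=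
  ⟨by rw [bind_gibbsKernel_apply_outside hΦ A hμ MeasurableSet.univ, measure_univ]⟩

lemma integral_bind_gibbsKernel_of_outside (hΦ : Φ.AbsSummable) (A : Finset G)
    (hμ : μ R.Omega = 1) {f : Θ × (G → S) → ℝ} (hf : Measurable[outside A] f) :
    ∫ p, f p ∂(μ.bind (gibbsKernel Φ A)) = ∫ p, f p ∂μ := by
  have htrim : (μ.bind (gibbsKernel Φ A)).trim (outside_le A) = μ.trim (outside_le A) := by
    refine @Measure.ext _ (outside A) _ _ fun s hs => ?_
    rw [trim_measurableSet_eq _ hs, trim_measurableSet_eq _ hs,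
      bind_gibbsKernel_apply_outside hΦ A hμ hs]
  rw [integral_trim (outside_le A) hf.stronglyMeasurable,
    integral_trim (outside_le A) hf.stronglyMeasurable, htrim]

lemma integrable_of_mem_Icc {f : Θ × (G → S) → ℝ} (hf : Measurable f)
    (h : ∀ᵐ p ∂μ, f p ∈ Set.Icc 0 1) : Integrable f μ :=
  Integrable.of_bound hf.aestronglyMeasurable 1 <| h.mono fun p hp => by
    rw [Real.norm_eq_abs, abs_of_nonneg hp.1]; exact hp.2

lemma condExp_cyl_bind_gibbsKernel (hΦ : Φ.AbsSummable) (A : Finset G)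
    (hμ : μ R.Omega = 1) (u : A → S) :
    gibbsWeight Φ A u =ᵐ[μ.bind (gibbsKernel Φ A)]
      (μ.bind (gibbsKernel Φ A))[(cyl A u).indicator (fun _ => (1 : ℝ)) | outside A] := by
  classical
  have := isProbabilityMeasure_bind_gibbsKernel hΦ A hμ
  have hw := measurable_gibbsWeight_outside hΦ A u
  have hint : ∀ (ν : Measure (Θ × (G → S))) [IsProbabilityMeasure ν],
      Integrable (gibbsWeight Φ A u) ν := fun ν _ =>
    integrable_of_mem_Icc (measurable_gibbsWeight hΦ A u)
      (.of_forall fun p => ⟨gibbsWeight_nonneg Φ A u p, gibbsWeight_le_one Φ A u p⟩)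
  refine ae_eq_condExp_of_forall_setIntegral_eq (outside_le A)
    ((integrable_const _).indicator (measurableSet_cyl A u))
    (fun s _ _ => (hint _).integrableOn) (fun s hs _ => ?_)
    hw.stronglyMeasurable.aestronglyMeasurable
  have hs' : MeasurableSet s := outside_le A _ hs
  have hcs : MeasurableSet (s ∩ cyl A u) := hs'.inter (measurableSet_cyl A u)
  rw [← integral_indicator hs', integral_bind_gibbsKernel_of_outside hΦ A hμ (hw.indicator hs),
    setIntegral_indicator (measurableSet_cyl A u), setIntegral_const, smul_eq_mul, mul_one,
    Measure.real, bind_gibbsKernel_apply hΦ A μ hcs,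
    integral_eq_lintegral_of_nonneg_ae
      (.of_forall fun p => Set.indicator_nonneg (fun _ _ => gibbsWeight_nonneg Φ A u _) p)
      ((hint μ).indicator hs').aestronglyMeasurable]
  congr 1
  refine lintegral_congr fun p => ?_
  by_cases hp : p ∈ s
  · simp [Set.indicator_apply, mergePoint_mem_iff_of_outside hs, mergePoint_mem_cyl_iff, hp]
  · simp [mergePoint_mem_iff_of_outside hs, hp]

end Kernel

section ConditionalExpectation

variable {μ : Measure (Θ × (G → S))} [IsProbabilityMeasure μ]

/-- The conditional probability of the pattern `u` given the environment and the
configuration off `A`. -/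
def patternProb (μ : Measure (Θ × (G → S))) (A : Finset G) (u : A → S) : Θ × (G → S) → ℝ :=
  μ[(cyl A u).indicator (fun _ => (1 : ℝ)) | outside A]

lemma measurable_patternProb (A : Finset G) (u : A → S) : Measurable (patternProb μ A u) :=
  (stronglyMeasurable_condExp.mono (outside_le A)).measurable

lemma integrable_cyl_indicator (A : Finset G) (u : A → S) :
    Integrable ((cyl A u).indicator (fun _ => (1 : ℝ))) μ :=
  (integrable_const _).indicator (measurableSet_cyl A u)

lemma sum_cyl_indicator (A : Finset G) (f : (A → S) → Θ × (G → S) → ℝ) (p : Θ × (G → S)) :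
    ∑ u : A → S, (cyl A u).indicator (fun _ => (1 : ℝ)) p * f u p = f (fun a => p.2 a) p := by
  classical
  simp [Set.indicator_apply, mem_cyl_iff]

lemma patternProb_nonneg (A : Finset G) : ∀ᵐ p ∂μ, ∀ u : A → S, 0 ≤ patternProb μ A u p :=
  ae_all_iff.2 fun _ => condExp_nonneg
    (.of_forall fun p => Set.indicator_nonneg (fun _ _ => zero_le_one) p)

lemma sum_patternProb (A : Finset G) : ∀ᵐ p ∂μ, ∑ u : A → S, patternProb μ A u p = 1 := by
  have h := condExp_finsetSum (μ := μ) (s := (Finset.univ : Finset (A → S)))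
    (fun u _ => integrable_cyl_indicator A u) (outside A)
  have hone : ∑ u : A → S, (cyl A u : Set (Θ × (G → S))).indicator (fun _ => (1 : ℝ)) =
      fun _ => 1 := by
    funext p
    simpa using sum_cyl_indicator A (fun _ _ => 1) p
  rw [hone, condExp_const (outside_le A)] at h
  filter_upwards [h] with p hp
  simpa [patternProb] using hp.symm

lemma patternProb_eq_zero (A : Finset G) (hμ : μ R.Omega = 1) :
    ∀ᵐ p ∂μ, ∀ u : A → S, mergePoint A u p ∉ R.Omega → patternProb μ A u p = 0 := by
  refine ae_all_iff.2 fun u => ?_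
  have hD : MeasurableSet[outside A] (mergePoint A u ⁻¹' R.Omegaᶜ) :=
    measurable_mergePoint_outside A u R.omega_measurable.compl
  have hz : (mergePoint A u ⁻¹' R.Omegaᶜ).indicator ((cyl A u).indicator fun _ => (1 : ℝ))
      =ᵐ[μ] 0 := by
    filter_upwards [ae_mem_Omega hμ] with p hp
    rw [Set.indicator_indicator]
    refine Set.indicator_of_notMem (fun h => h.1 ?_) _
    rwa [mergePoint_eq_self_of_mem_cyl h.2]
  have h := condExp_indicator (integrable_cyl_indicator (μ := μ) A u) hD
  have h' := condExp_congr_ae (m := outside A) hz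
  rw [condExp_zero] at h'
  filter_upwards [h, h'] with p hp hp' hmem
  rw [hp, Set.indicator_of_mem (show p ∈ mergePoint A u ⁻¹' R.Omegaᶜ from hmem)] at hp'
  exact hp'

lemma patternProb_mem_Icc (A : Finset G) :
    ∀ᵐ p ∂μ, ∀ u : A → S, patternProb μ A u p ∈ Set.Icc 0 1 := by
  filter_upwards [patternProb_nonneg A, sum_patternProb A] with p h0 h1 u
  exact ⟨h0 u, h1 ▸ Finset.single_le_sum (f := fun u => patternProb μ A u p)
    (fun u _ => h0 u) (Finset.mem_univ u)⟩

lemma integrable_mul_of_mem_Icc {q f : Θ × (G → S) → ℝ} (hq : Measurable q)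
    (hq' : ∀ᵐ p ∂μ, q p ∈ Set.Icc 0 1) (hf : Measurable f) {c : ℝ} (hc : ∀ p, |f p| ≤ c) :
    Integrable (fun p => q p * f p) μ :=
  (integrable_of_mem_Icc hq hq').mul_bdd hf.aestronglyMeasurable (.of_forall hc)

/-- A bounded observable may be averaged over the patterns on `A` first. -/
lemma integral_eq_integral_sum_patternProb (A : Finset G) {f : Θ × (G → S) → ℝ}
    (hf : Measurable f) {c : ℝ} (hc : ∀ p, |f p| ≤ c) :
    ∫ p, f p ∂μ = ∫ p, ∑ u : A → S, patternProb μ A u p * f (mergePoint A u p) ∂μ := by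
  have hfu : ∀ u : A → S, Measurable fun p => f (mergePoint A u p) :=
    fun u => hf.comp (measurable_mergePoint A u)
  have hint : ∀ u : A → S, Integrable
      ((cyl A u).indicator (fun _ => (1 : ℝ)) * fun p => f (mergePoint A u p)) μ := fun u =>
    (integrable_cyl_indicator A u).mul_bdd (hfu u).aestronglyMeasurable
      (.of_forall fun p => hc _)
  have hdecomp : f = fun p => ∑ u : A → S,
      ((cyl A u : Set (Θ × (G → S))).indicator (fun _ => (1 : ℝ)) *
        fun p => f (mergePoint A u p) : Θ × (G → S) → ℝ) p := by
    funext p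
    refine Eq.trans ?_ (sum_cyl_indicator A (fun u p => f (mergePoint A u p)) p).symm
    rw [mergePoint_eq_self_of_mem_cyl (mem_cyl_iff.2 rfl)]
  rw [congrArg (fun g => ∫ p, g p ∂μ) hdecomp, integral_finsetSum _ fun u _ => hint u,
    integral_finsetSum _ fun u _ => integrable_mul_of_mem_Icc (measurable_patternProb A u)
    ((patternProb_mem_Icc A).mono fun p hp => hp u) (hfu u) fun p => hc _]
  refine Finset.sum_congr rfl fun u _ => ?_
  rw [← integral_condExp (outside_le A)]
  refine integral_congr_ae ?_
  exact condExp_mul_of_stronglyMeasurable_right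
    (hf.comp (measurable_mergePoint_outside A u)).stronglyMeasurable (hint u)
    (integrable_cyl_indicator A u)

end ConditionalExpectation

section Pressure

variable {Φ : Interaction G S Θ R} {μ : Measure (Θ × (G → S))} [IsProbabilityMeasure μ]

/-- Entropy minus mean energy of the pattern distribution `q` at a point. -/
def localPressure (Φ : Interaction G S Θ R) (A : Finset G) (q : (A → S) → Θ × (G → S) → ℝ)
    (p : Θ × (G → S)) : ℝ :=
  (∑ u : A → S, Real.negMulLog (q u p)) -
    ∑ u : A → S, q u p * condEnergy Φ A (mergePoint A u p)

lemma localPressure_le_and_eq_iff (Φ : Interaction G S Θ R) (A : Finset G)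
    {q : (A → S) → Θ × (G → S) → ℝ} {p : Θ × (G → S)} (hp : p ∈ R.Omega)
    (hq : ∀ u, 0 ≤ q u p) (hqs : ∑ u, q u p = 1)
    (hq0 : ∀ u, mergePoint A u p ∉ R.Omega → q u p = 0) :
    localPressure Φ A q p ≤ Real.log (partitionZ Φ A p) ∧
      (localPressure Φ A q p = Real.log (partitionZ Φ A p) ↔
        ∀ u, q u p = gibbsWeight Φ A u p) := by
  refine finite_variational_principle hq hqs (sum_gibbsWeight Φ A hp) fun u => ?_
  by_cases hu : mergePoint A u p ∈ R.Omega
  · right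
    have hZ := partitionZ_pos Φ A hp
    rw [gibbsWeight, boltzmann_of_mem Φ A hu, Real.log_div (Real.exp_pos _).ne' hZ.ne',
      Real.log_exp]
    exact ⟨div_pos (Real.exp_pos _) hZ, rfl⟩
  · left
    exact ⟨by rw [gibbsWeight, boltzmann_of_notMem Φ A hu, zero_div], hq0 u hu⟩

lemma localPressure_gibbsWeight (Φ : Interaction G S Θ R) (A : Finset G) {p : Θ × (G → S)}
    (hp : p ∈ R.Omega) :
    localPressure Φ A (gibbsWeight Φ A) p = Real.log (partitionZ Φ A p) :=
  (localPressure_le_and_eq_iff Φ A hp (fun u => gibbsWeight_nonneg Φ A u p)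
    (sum_gibbsWeight Φ A hp) fun u hu => by
      rw [gibbsWeight, boltzmann_of_notMem Φ A hu, zero_div]).2.2 fun _ => rfl

lemma ae_localPressure_patternProb (Φ : Interaction G S Θ R) (A : Finset G)
    (hμ : μ R.Omega = 1) : ∀ᵐ p ∂μ,
    localPressure Φ A (patternProb μ A) p ≤ Real.log (partitionZ Φ A p) ∧
      (localPressure Φ A (patternProb μ A) p = Real.log (partitionZ Φ A p) ↔
        ∀ u, patternProb μ A u p = gibbsWeight Φ A u p) := by
  filter_upwards [ae_mem_Omega hμ, patternProb_nonneg A, sum_patternProb A,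
    patternProb_eq_zero A hμ] with p hp h0 h1 hz
  exact localPressure_le_and_eq_iff Φ A hp h0 h1 hz

lemma integrable_negMulLog {q : Θ × (G → S) → ℝ} (hq : Measurable q)
    (h : ∀ᵐ p ∂μ, q p ∈ Set.Icc 0 1) : Integrable (fun p => Real.negMulLog (q p)) μ := by
  refine integrable_of_mem_Icc (Real.continuous_negMulLog.measurable.comp hq) ?_
  filter_upwards [h] with p hp
  have := (negMulLog_add_mul_log_le hp.1 one_pos).1
  exact ⟨Real.negMulLog_nonneg hp.1 hp.2, by simp at this; linarith [hp.1]⟩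

lemma integrable_sum_mul_condEnergy (hΦ : Φ.AbsSummable) (A : Finset G)
    {q : (A → S) → Θ × (G → S) → ℝ} (hq : ∀ u, Measurable (q u))
    (h : ∀ᵐ p ∂μ, ∀ u, q u p ∈ Set.Icc 0 1) :
    Integrable (fun p => ∑ u : A → S, q u p * condEnergy Φ A (mergePoint A u p)) μ := by
  obtain ⟨c, hc⟩ := exists_abs_condEnergy_le hΦ A
  exact integrable_finsetSum _ fun u _ => integrable_mul_of_mem_Icc (hq u)
    (h.mono fun p hp => hp u) ((measurable_condEnergy hΦ A).comp (measurable_mergePoint A u))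
    fun p => hc _

lemma integrable_sum_negMulLog (A : Finset G)
    {q : (A → S) → Θ × (G → S) → ℝ} (hq : ∀ u, Measurable (q u))
    (h : ∀ᵐ p ∂μ, ∀ u, q u p ∈ Set.Icc 0 1) :
    Integrable (fun p => ∑ u : A → S, Real.negMulLog (q u p)) μ :=
  integrable_finsetSum _ fun u _ => integrable_negMulLog (hq u) (h.mono fun _ hp => hp u)

lemma integrable_localPressure (hΦ : Φ.AbsSummable) (A : Finset G)
    {q : (A → S) → Θ × (G → S) → ℝ} (hq : ∀ u, Measurable (q u))
    (h : ∀ᵐ p ∂μ, ∀ u, q u p ∈ Set.Icc 0 1) : Integrable (localPressure Φ A q) μ :=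
  (integrable_sum_negMulLog A hq h).sub (integrable_sum_mul_condEnergy hΦ A hq h)

lemma pressureCond_eq_integral (hΦ : Φ.AbsSummable) (A : Finset G)
    (μ : Measure (Θ × (G → S))) [IsProbabilityMeasure μ] :
    pressureCond Φ μ A = ∫ p, localPressure Φ A (patternProb μ A) p ∂μ := by
  obtain ⟨c, hc⟩ := exists_abs_condEnergy_le hΦ A
  rw [pressureCond, integral_eq_integral_sum_patternProb A (measurable_condEnergy hΦ A) hc]
  exact (integral_sub
    (integrable_sum_negMulLog A (measurable_patternProb A) (patternProb_mem_Icc A))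
    (integrable_sum_mul_condEnergy hΦ A (measurable_patternProb A)
      (patternProb_mem_Icc A))).symm

lemma pressureCond_bind_gibbsKernel (hΦ : Φ.AbsSummable) (A : Finset G)
    (hμ : μ R.Omega = 1) :
    pressureCond Φ (μ.bind (gibbsKernel Φ A)) A =
      ∫ p, localPressure Φ A (gibbsWeight Φ A) p ∂μ := by
  have := isProbabilityMeasure_bind_gibbsKernel hΦ A hμ
  rw [pressureCond_eq_integral hΦ A, ← integral_bind_gibbsKernel_of_outside hΦ A hμ]
  · refine integral_congr_ae ?_
    filter_upwards [ae_all_iff.2 (condExp_cyl_bind_gibbsKernel hΦ A hμ)] with p hp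
    simp only [localPressure, patternProb, hp]
  · refine Measurable.sub ?_ ?_
    · exact Finset.measurable_sum _ fun u _ =>
        Real.continuous_negMulLog.measurable.comp (measurable_gibbsWeight_outside hΦ A u)
    · exact Finset.measurable_sum _ fun u _ => (measurable_gibbsWeight_outside hΦ A u).mul
        ((measurable_condEnergy hΦ A).comp (measurable_mergePoint_outside A u))

lemma bind_gibbsKernel_eq_self (hΦ : Φ.AbsSummable) (A : Finset G)
    (h : ∀ᵐ p ∂μ, ∀ u, patternProb μ A u p = gibbsWeight Φ A u p) :
    μ.bind (gibbsKernel Φ A) = μ := by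
  ext W hW
  have hf : Measurable (W.indicator (fun _ => (1 : ℝ))) := measurable_const.indicator hW
  have hc : ∀ p, |W.indicator (fun _ => (1 : ℝ)) p| ≤ 1 := fun p => by
    by_cases hp : p ∈ W <;> simp [hp]
  have hnn : ∀ p, 0 ≤ W.indicator (fun _ => (1 : ℝ)) p :=
    Set.indicator_nonneg fun _ _ => zero_le_one
  have key : μ.real W = ∫ p, ∑ u : A → S,
      gibbsWeight Φ A u p * W.indicator (fun _ => (1 : ℝ)) (mergePoint A u p) ∂μ := by
    rw [← integral_indicator_one hW]
    refine (integral_eq_integral_sum_patternProb A hf hc).trans (integral_congr_ae ?_)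
    filter_upwards [h] with p hp
    simp only [hp]
  rw [← ofReal_measureReal (measure_ne_top μ W), key, bind_gibbsKernel_apply hΦ A μ hW,
    ofReal_integral_eq_lintegral_ofReal]
  · refine lintegral_congr fun p => ?_
    rw [ENNReal.ofReal_sum_of_nonneg fun u _ => mul_nonneg (gibbsWeight_nonneg Φ A u p) (hnn _)]
    refine Finset.sum_congr rfl fun u _ => ?_
    rw [ENNReal.ofReal_mul (gibbsWeight_nonneg Φ A u p)]
    by_cases hu : mergePoint A u p ∈ W <;> simp [hu]
  · exact integrable_finsetSum _ fun u _ => integrable_mul_of_mem_Icc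
      (measurable_gibbsWeight hΦ A u)
      (.of_forall fun p => ⟨gibbsWeight_nonneg Φ A u p, gibbsWeight_le_one Φ A u p⟩)
      (hf.comp (measurable_mergePoint A u)) fun p => hc _
  · exact .of_forall fun p => Finset.sum_nonneg fun u _ =>
      mul_nonneg (gibbsWeight_nonneg Φ A u p) (hnn _)

end Pressure

/-- **Local optimality of relative Gibbs measures** (Corollary 2.6 of
Barbieri–Gómez–Marcus–Taati): the finitary variational principle applied to the
Gibbs kernels, both pointwise and in integrated form. -/
theorem local_optimality_of_relative_gibbs
    {G : Type} [Group G] [Countable G] [DecidableEq G]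
    {S : Type} [Fintype S] [Nonempty S] [TopologicalSpace S] [DiscreteTopology S]
    [MeasurableSpace S] [MeasurableSingletonClass S]
    {Θ : Type} [MeasurableSpace Θ]
    {R : RelSystem G S Θ} (Φ : Interaction G S Θ R) (hΦ : Φ.AbsSummable)
    (A : Finset G) (μ : Measure (Θ × (G → S))) [IsProbabilityMeasure μ]
    (hμΩ : μ R.Omega = 1)
    (q : (A → S) → Θ × (G → S) → ℝ)
    (hq : ∀ u : A → S, q u =ᵐ[μ]
      μ[Set.indicator (cyl A u) (fun _ => (1:ℝ)) | xi ((↑A : Set G)ᶜ) ⊔ FTheta]) :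
    ((∀ᵐ p ∂μ,
        (∑ u : A → S, Real.negMulLog (q u p)) -
          (∑ u : A → S, q u p * condEnergy Φ A (p.1, mergePat A p.2 u))
          ≤ Real.log (partitionZ Φ A p)) ∧
      (∀ᵐ p ∂μ,
        (((∑ u : A → S, Real.negMulLog (q u p)) -
            (∑ u : A → S, q u p * condEnergy Φ A (p.1, mergePat A p.2 u))
            = Real.log (partitionZ Φ A p)) ↔
          ∀ u : A → S, q u p = (gibbsKernel Φ A p (cyl A u)).toReal))) ∧
    ((pressureCond Φ μ A ≤ pressureCond Φ (μ.bind (gibbsKernel Φ A)) A) ∧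
      (pressureCond Φ μ A = pressureCond Φ (μ.bind (gibbsKernel Φ A)) A ↔
        μ.bind (gibbsKernel Φ A) = μ)) := by
  have hmain := ae_localPressure_patternProb Φ A hμΩ
  have hqq : ∀ᵐ p ∂μ, ∀ u, q u p = patternProb μ A u p := ae_all_iff.2 hq
  have hpoint : ∀ᵐ p ∂μ, localPressure Φ A q p = localPressure Φ A (patternProb μ A) p := by
    filter_upwards [hqq] with p hp
    simp only [localPressure, hp]
  refine ⟨⟨?_, ?_⟩, ?_⟩
  · filter_upwards [hmain, hpoint] with p hp hpq
    exact hpq.trans_le hp.1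
  · filter_upwards [hmain, hqq, hpoint] with p hp hq' hpq
    simp only [gibbsKernel_cyl_toReal, hq']
    rw [← hp.2, ← hpq]
    simp only [localPressure, mergePoint, hq']
  have hle : localPressure Φ A (patternProb μ A) ≤ᵐ[μ]
      localPressure Φ A (gibbsWeight Φ A) := by
    filter_upwards [hmain, ae_mem_Omega hμΩ] with p hp hΩ
    exact hp.1.trans_eq (localPressure_gibbsWeight Φ A hΩ).symm
  have hint := integrable_localPressure (μ := μ) hΦ A (measurable_patternProb A)
    (patternProb_mem_Icc A)
  have hint' := integrable_localPressure (μ := μ) hΦ A (measurable_gibbsWeight hΦ A)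
    (.of_forall fun p u => ⟨gibbsWeight_nonneg Φ A u p, gibbsWeight_le_one Φ A u p⟩)
  refine ⟨?_, fun h => ?_, fun h => by rw [h]⟩
  · rw [pressureCond_bind_gibbsKernel hΦ A hμΩ, pressureCond_eq_integral hΦ A μ]
    exact integral_mono_ae hint hint' hle
  · rw [pressureCond_bind_gibbsKernel hΦ A hμΩ, pressureCond_eq_integral hΦ A μ,
      integral_eq_iff_of_ae_le hint hint' hle] at h
    refine bind_gibbsKernel_eq_self hΦ A ?_
    filter_upwards [h, hmain, ae_mem_Omega hμΩ] with p hp hm hΩ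
    exact hm.2.1 (hp.trans (localPressure_gibbsWeight Φ A hΩ))

end DLR
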